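/- arXiv:1510.08955 — 2 statements merged into one kernel-verified Lean document; each statement's English description precedes it below -/
import Mathlib

section
/- Let f, F : ℤ → R satisfy F(n+1) - F(n) = f(n) for all n ∈ ℤ (F is a discrete antiderivative of f). Then, as R-linear operators on V, J∘M_f∘J = M_F∘J - J∘M_{ΛF}. (This is the operator identity Δ⁻¹∘f∘Δ⁻¹ = (Δ⁻¹f)∘Δ⁻¹ - Δ⁻¹∘Λ(Δ⁻¹f) of Lemma 2.1(2), realized on functions with support bounded below.) -/
open Finset

/-- A function `ℤ → R` has support bounded below. -/
def SuppBddBelow {A : Type*} [Zero A] (f : ℤ → A) : Prop :=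
  ∃ M : ℤ, ∀ n : ℤ, n < M → f n = 0

/-- The shift operator `(Λ f)(n) = f(n+1)`. -/
def shiftL {A : Type*} (f : ℤ → A) : ℤ → A := fun n => f (n + 1)

/-- The summation operator `(J f)(n) = ∑_{m < n} f(m)` (a finite sum when the
support of `f` is bounded below, realized via `finsum`). -/
noncomputable def Jop {A : Type*} [AddCommMonoid A] (f : ℤ → A) : ℤ → A :=
  fun n => ∑ᶠ (m : ℤ) (_ : m < n), f m

theorem Jop_eq_zero {A : Type*} [AddCommMonoid A] {f : ℤ → A} {M n : ℤ}
    (hf : ∀ m < M, f m = 0) (hn : n ≤ M) : Jop f n = 0 := by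
  have h : ∀ m, ∑ᶠ _ : m < n, f m = 0 := fun m =>
    finsum_induction (· = 0) rfl (fun _ _ hx hy => by simp [hx, hy])
      fun hm => hf m (hm.trans_le hn)
  simp only [Jop, h, finsum_zero]

theorem Jop_eq_sum_Ico {A : Type*} [AddCommMonoid A] {f : ℤ → A} {M : ℤ}
    (hf : ∀ m < M, f m = 0) (n : ℤ) : Jop f n = ∑ m ∈ Finset.Ico M n, f m := by
  refine finsum_cond_eq_sum_of_cond_iff f fun {m} hm => ?_
  have hMm : M ≤ m := not_lt.mp fun h => hm (hf m h)
  simp [hMm]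

theorem Jop_add_one {A : Type*} [AddCommMonoid A] {f : ℤ → A}
    (hf : SuppBddBelow f) (n : ℤ) : Jop f (n + 1) = Jop f n + f n := by
  obtain ⟨M, hM⟩ := hf
  have hM' : ∀ m < min M n, f m = 0 := fun m hm => hM m (hm.trans_le (min_le_left _ _))
  have hIco : Finset.Ico (min M n) (n + 1) = insert n (Finset.Ico (min M n) n) := by
    ext m
    simp only [Finset.mem_insert, Finset.mem_Ico]
    omega
  rw [Jop_eq_sum_Ico hM', Jop_eq_sum_Ico hM', hIco,
    Finset.sum_insert Finset.right_notMem_Ico, add_comm]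

/-- if `F` is a discrete antiderivative of `f`, then as operators on the
module of functions with support bounded below, `J∘M_f∘J = M_F∘J - J∘M_{ΛF}`. -/
theorem stmt0 {R : Type*} [CommRing R] (f F : ℤ → R)
    (hF : ∀ n : ℤ, F (n + 1) - F n = f n) :
    ∀ g : ℤ → R, SuppBddBelow g → ∀ n : ℤ,
      Jop (fun k => f k * Jop g k) n
        = F n * Jop g n - Jop (fun k => shiftL F k * g k) n := by
  rintro g ⟨M, hM⟩ n
  have hJ : ∀ k < M, f k * Jop g k = 0 := fun k hk => by
    rw [Jop_eq_zero hM hk.le, mul_zero]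
  have hS : ∀ k < M, shiftL F k * g k = 0 := fun k hk => by rw [hM k hk, mul_zero]
  rcases le_total n M with hn | hn
  · rw [Jop_eq_zero hJ hn, Jop_eq_zero hM hn, Jop_eq_zero hS hn]
    simp
  · induction n, hn using Int.leInduction with
    | base =>
      rw [Jop_eq_zero hJ le_rfl, Jop_eq_zero hM le_rfl, Jop_eq_zero hS le_rfl]
      simp
    | succ n _ ih =>
      rw [Jop_add_one ⟨M, hJ⟩, Jop_add_one ⟨M, hM⟩, Jop_add_one ⟨M, hS⟩, ih, ← hF n, shiftL]
      ring
end

section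
/- Let b₀, …, bₙ : ℤ → Matrix (Fin r) (Fin r) R, φ : ℤ → Matrix (Fin r) (Fin m) R and ψ : ℤ → Matrix (Fin m) (Fin r) R. Let B = Σ_{i=0}^{n} M_{b_i}∘Δ^i acting on V_r, let T : V_r → V_r be T(g) = φ·J(ψ·g), and set B(φ) := Σ_{i=0}^{n} b_i·Δ^i(φ) and B*(ψ) := Σ_{i=0}^{n} (-1)^i Δ^i(Λ⁻ⁱ(ψ·b_i)). Then there exist c₀, …, c_{n-1} : ℤ → Matrix (Fin r) (Fin r) R such that, as operators on V_r, B∘T - T∘B = M_{B(φ)}∘J∘M_ψ - M_φ∘J∘M_{B*(ψ)} + Σ_{i=0}^{n-1} M_{c_i}∘Δ^i. (This is the lemma [Bₙ, φΔ⁻¹ψ]₋ = Bₙ(φ)Δ⁻¹ψ - φΔ⁻¹Bₙ*(ψ) for the discrete constrained multi-component KP hierarchy.) -/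
open Finset

/-- The inverse shift operator `(Λ⁻¹ f)(n) = f(n-1)` (applied entrywise). -/
def shiftLinv {A : Type*} (f : ℤ → A) : ℤ → A := fun n => f (n - 1)

/-- The difference operator `(Δ f)(n) = f(n+1) - f(n)` (applied entrywise). -/
def Del {A : Type*} [AddCommGroup A] (f : ℤ → A) : ℤ → A := fun n => f (n + 1) - f n

variable {R : Type*} [CommRing R]

/-- The local difference operator `B = Σ_{i=0}^{n} M_{b_i}∘Δⁱ` acting on `V_r`. -/
noncomputable def Bop {r : ℕ} (n : ℕ) (b : ℕ → ℤ → Matrix (Fin r) (Fin r) R)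
    (g : ℤ → Fin r → R) : ℤ → Fin r → R :=
  fun k => ∑ i ∈ Finset.range (n + 1), (b i k).mulVec (Del^[i] g k)

/-- The operator `T(g) = φ·J(ψ·g)` acting on `V_r`. -/
noncomputable def TTop {r m : ℕ} (φ : ℤ → Matrix (Fin r) (Fin m) R)
    (ψ : ℤ → Matrix (Fin m) (Fin r) R) (g : ℤ → Fin r → R) : ℤ → Fin r → R :=
  fun k => (φ k).mulVec (Jop (fun j => (ψ j).mulVec (g j)) k)

/-- `B(φ) = Σ_{i=0}^{n} b_i·Δⁱ(φ)`. -/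
noncomputable def BMat {r m : ℕ} (n : ℕ) (b : ℕ → ℤ → Matrix (Fin r) (Fin r) R)
    (φ : ℤ → Matrix (Fin r) (Fin m) R) : ℤ → Matrix (Fin r) (Fin m) R :=
  fun k => ∑ i ∈ Finset.range (n + 1), b i k * Del^[i] φ k

/-- `B*(ψ) = Σ_{i=0}^{n} (-1)ⁱ Δⁱ(Λ⁻ⁱ(ψ·b_i))`. -/
noncomputable def BStarMat {r m : ℕ} (n : ℕ) (b : ℕ → ℤ → Matrix (Fin r) (Fin r) R)
    (ψ : ℤ → Matrix (Fin m) (Fin r) R) : ℤ → Matrix (Fin m) (Fin r) R :=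
  fun k => ∑ i ∈ Finset.range (n + 1),
    ((-1 : R) ^ i) • Del^[i] (shiftLinv^[i] (fun j => ψ j * b i j)) k

/-- The operator `L` agrees on `V_r` with a difference operator `Σ_{i<n} M_{c_i}∘Δⁱ`. -/
def IsLocalOp {r p : ℕ} (n : ℕ) (L : (ℤ → Fin r → R) → ℤ → Fin p → R) : Prop :=
  ∃ c : ℕ → ℤ → Matrix (Fin p) (Fin r) R, ∀ g : ℤ → Fin r → R, SuppBddBelow g → ∀ k : ℤ,
    L g k = ∑ i ∈ Finset.range n, (c i k).mulVec (Del^[i] g k)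

namespace SuppBddBelow

variable {A : Type*}

lemma of_imp {B : Type*} [Zero A] [Zero B] {f : ℤ → A} {g : ℤ → B} (hf : SuppBddBelow f)
    (h : ∀ k, f k = 0 → g k = 0) : SuppBddBelow g := by
  obtain ⟨M, hM⟩ := hf
  exact ⟨M, fun k hk => h k (hM k hk)⟩

lemma add [AddZeroClass A] {f g : ℤ → A} (hf : SuppBddBelow f) (hg : SuppBddBelow g) :
    SuppBddBelow (fun k => f k + g k) := by
  obtain ⟨M, hM⟩ := hf
  obtain ⟨N, hN⟩ := hg
  refine ⟨min M N, fun k hk => ?_⟩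
  rw [lt_min_iff] at hk
  simp [hM k hk.1, hN k hk.2]

lemma sub [AddGroup A] {f g : ℤ → A} (hf : SuppBddBelow f) (hg : SuppBddBelow g) :
    SuppBddBelow (fun k => f k - g k) := by
  simpa [sub_eq_add_neg] using hf.add (hg.of_imp (g := fun k => -g k) (by simp))

lemma sum [AddCommMonoid A] {ι : Type*} {s : Finset ι} {f : ι → ℤ → A}
    (hf : ∀ i ∈ s, SuppBddBelow (f i)) : SuppBddBelow (fun k => ∑ i ∈ s, f i k) := by
  classical
  induction s using Finset.induction_on with
  | empty => exact ⟨0, by simp⟩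
  | insert a s ha ih =>
    simp only [Finset.sum_insert ha]
    exact (hf a (by simp)).add (ih fun i hi => hf i (by simp [hi]))

lemma del [AddCommGroup A] {f : ℤ → A} (hf : SuppBddBelow f) : SuppBddBelow (Del f) := by
  obtain ⟨M, hM⟩ := hf
  refine ⟨M - 1, fun k hk => ?_⟩
  simp [Del, hM k (by omega), hM (k + 1) (by omega)]

lemma del_iterate [AddCommGroup A] {f : ℤ → A} (hf : SuppBddBelow f) (i : ℕ) :
    SuppBddBelow (Del^[i] f) := by
  induction i with
  | zero => exact hf
  | succ i ih => rw [Function.iterate_succ_apply']; exact ih.del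

lemma mulVec {p q : ℕ} {g : ℤ → Fin q → R} (hg : SuppBddBelow g)
    (a : ℤ → Matrix (Fin p) (Fin q) R) : SuppBddBelow (fun k => (a k).mulVec (g k)) :=
  hg.of_imp fun k hk => by simp [hk]

lemma jop [AddCommMonoid A] {f : ℤ → A} (hf : SuppBddBelow f) : SuppBddBelow (Jop f) := by
  obtain ⟨M, hM⟩ := hf
  refine ⟨M, fun k hk => finsum_mem_eq_zero_of_forall_eq_zero fun j hj => hM j ?_⟩
  exact lt_trans hj hk

lemma jop_add_one [AddCommMonoid A] {f : ℤ → A} (hf : SuppBddBelow f) (k : ℤ) :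
    Jop f (k + 1) = f k + Jop f k := by
  obtain ⟨M, hM⟩ := hf
  have hset : {j : ℤ | j < k + 1} = insert k {j : ℤ | j < k} := by
    ext j
    simp only [Set.mem_ofPred_eq, Set.mem_insert_iff]
    omega
  have hfin : ({j : ℤ | j < k} ∩ Function.support f).Finite := by
    refine (Set.finite_Icc M k).subset fun j hj => ⟨?_, le_of_lt hj.1⟩
    by_contra hlt
    exact hj.2 (hM j (not_le.mp hlt))
  change ∑ᶠ j ∈ {j : ℤ | j < k + 1}, f j = f k + ∑ᶠ j ∈ {j : ℤ | j < k}, f j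
  rw [hset, finsum_mem_insert' f (by simp) hfin]

lemma eq_zero_of_del_eq_zero [AddCommGroup A] {f : ℤ → A} (hf : SuppBddBelow f)
    (h : ∀ k, f (k + 1) = f k) (k : ℤ) : f k = 0 := by
  obtain ⟨M, hM⟩ := hf
  rcases lt_or_ge k M with hk | hk
  · exact hM k hk
  · have hstep : ∀ j, M - 1 ≤ j → f j = 0 := fun j hj =>
      Int.leInduction (hM _ (by omega)) (fun i _ hi => (h i).trans hi) j hj
    exact hstep k (by omega)

lemma jop_eq [AddCommGroup A] {f F : ℤ → A} (hf : SuppBddBelow f) (hF : SuppBddBelow F)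
    (h : ∀ k, F (k + 1) = f k + F k) (k : ℤ) : Jop f k = F k := by
  refine sub_eq_zero.mp ((hf.jop.sub hF).eq_zero_of_del_eq_zero (fun j => ?_) k)
  rw [hf.jop_add_one, h]
  abel

end SuppBddBelow

lemma Jop_sum {A ι : Type*} [AddCommGroup A] {s : Finset ι} {f : ι → ℤ → A}
    (hf : ∀ i ∈ s, SuppBddBelow (f i)) (k : ℤ) :
    Jop (fun j => ∑ i ∈ s, f i j) k = ∑ i ∈ s, Jop (f i) k := by
  refine (SuppBddBelow.sum hf).jop_eq (F := fun k => ∑ i ∈ s, Jop (f i) k)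
    (SuppBddBelow.sum fun i hi => (hf i hi).jop) (fun j => ?_) k
  rw [← Finset.sum_add_distrib]
  exact Finset.sum_congr rfl fun i hi => (hf i hi).jop_add_one j

/-- Summation by parts. -/
lemma Jop_mulVec_Del {p q : ℕ} (a : ℤ → Matrix (Fin p) (Fin q) R) {g : ℤ → Fin q → R}
    (hg : SuppBddBelow g) (k : ℤ) :
    Jop (fun j => (a j).mulVec (Del g j)) k
      = (a (k - 1)).mulVec (g k) - Jop (fun j => (Del (shiftLinv a) j).mulVec (g j)) k := by
  have hJ := hg.mulVec (Del (shiftLinv a))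
  refine (hg.del.mulVec a).jop_eq
    (F := fun k => (a (k - 1)).mulVec (g k)
      - Jop (fun j => (Del (shiftLinv a) j).mulVec (g j)) k)
    ((hg.mulVec fun k => a (k - 1)).sub hJ.jop) (fun j => ?_) k
  rw [hJ.jop_add_one]
  simp only [Del, shiftLinv, add_sub_cancel_right, Matrix.mulVec_sub, Matrix.sub_mulVec]
  abel

lemma Del_shiftLinv_iterate_succ {A : Type*} [AddCommGroup A] (f : ℤ → A) (i : ℕ) :
    Del^[i + 1] (shiftLinv^[i + 1] f) = Del^[i] (shiftLinv^[i] (Del (shiftLinv f))) := by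
  have hcomm : Function.Commute (Del (A := A)) shiftLinv := fun f => by
    ext k
    simp [Del, shiftLinv]
  rw [Function.iterate_succ_apply, Function.iterate_succ_apply,
    (hcomm.iterate_right i).eq]

namespace IsLocalOp

variable {r p q n : ℕ}

lemma congr {L L' : (ℤ → Fin r → R) → ℤ → Fin p → R} (hL : IsLocalOp n L)
    (h : ∀ g, SuppBddBelow g → ∀ k, L' g k = L g k) : IsLocalOp n L' := by
  obtain ⟨c, hc⟩ := hL
  exact ⟨c, fun g hg k => (h g hg k).trans (hc g hg k)⟩

lemma term (a : ℤ → Matrix (Fin p) (Fin r) R) {i : ℕ} (hi : i < n) :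
    IsLocalOp n (fun g k => (a k).mulVec (Del^[i] g k)) := by
  refine ⟨fun j k => if j = i then a k else 0, fun g _ k => ?_⟩
  rw [Finset.sum_eq_single_of_mem i (Finset.mem_range.mpr hi)]
  · simp
  · intro j _ hj
    simp [hj]

lemma zero : IsLocalOp n (fun (_ : ℤ → Fin r → R) (_ : ℤ) => (0 : Fin p → R)) :=
  ⟨0, by simp⟩

lemma add {L L' : (ℤ → Fin r → R) → ℤ → Fin p → R} (hL : IsLocalOp n L)
    (hL' : IsLocalOp n L') : IsLocalOp n (fun g k => L g k + L' g k) := by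
  obtain ⟨c, hc⟩ := hL
  obtain ⟨d, hd⟩ := hL'
  refine ⟨c + d, fun g hg k => ?_⟩
  simp [hc g hg, hd g hg, Matrix.add_mulVec, Finset.sum_add_distrib]

lemma mulVec {L : (ℤ → Fin r → R) → ℤ → Fin p → R} (hL : IsLocalOp n L)
    (a : ℤ → Matrix (Fin q) (Fin p) R) : IsLocalOp n (fun g k => (a k).mulVec (L g k)) := by
  obtain ⟨c, hc⟩ := hL
  refine ⟨fun i k => a k * c i k, fun g hg k => ?_⟩
  simp [hc g hg, Matrix.mulVec_sum]

lemma neg {L : (ℤ → Fin r → R) → ℤ → Fin p → R} (hL : IsLocalOp n L) :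
    IsLocalOp n (fun g k => -L g k) :=
  (hL.mulVec fun _ => -1).congr fun g _ k => by simp [Matrix.neg_mulVec]

lemma sub {L L' : (ℤ → Fin r → R) → ℤ → Fin p → R} (hL : IsLocalOp n L)
    (hL' : IsLocalOp n L') : IsLocalOp n (fun g k => L g k - L' g k) := by
  simpa only [sub_eq_add_neg] using hL.add hL'.neg

lemma sum {ι : Type*} {s : Finset ι} {L : ι → (ℤ → Fin r → R) → ℤ → Fin p → R}
    (hL : ∀ i ∈ s, IsLocalOp n (L i)) : IsLocalOp n (fun g k => ∑ i ∈ s, L i g k) := by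
  classical
  induction s using Finset.induction_on with
  | empty => simpa using zero
  | insert a s ha ih =>
    simp only [Finset.sum_insert ha]
    exact (hL a (by simp)).add (ih fun i hi => hL i (by simp [hi]))

lemma mono {l : ℕ} {L : (ℤ → Fin r → R) → ℤ → Fin p → R} (hL : IsLocalOp l L) (h : l ≤ n) :
    IsLocalOp n L := by
  obtain ⟨c, hc⟩ := hL
  exact (sum fun i hi => term (c i) ((Finset.mem_range.mp hi).trans_le h)).congr hc

lemma del {L : (ℤ → Fin r → R) → ℤ → Fin p → R} (hL : IsLocalOp n L) :
    IsLocalOp (n + 1) (fun g => Del (L g)) := by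
  obtain ⟨c, hc⟩ := hL
  have hsum : IsLocalOp (n + 1) (fun (g : ℤ → Fin r → R) k => ∑ i ∈ Finset.range n,
      ((c i (k + 1)).mulVec (Del^[i + 1] g k) + (Del (c i) k).mulVec (Del^[i] g k))) :=
    sum fun i hi => by
      have hi := Finset.mem_range.mp hi
      exact (term (fun k => c i (k + 1)) (by omega)).add (term (Del (c i)) (by omega))
  refine hsum.congr fun g hg k => ?_
  simp only [Del, hc g hg, Function.iterate_succ_apply', ← Finset.sum_sub_distrib,
    Matrix.mulVec_sub, Matrix.sub_mulVec]
  exact Finset.sum_congr rfl fun i _ => by abel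

end IsLocalOp

lemma isLocalOp_Del_iterate_TTop {r m : ℕ} (φ : ℤ → Matrix (Fin r) (Fin m) R)
    (ψ : ℤ → Matrix (Fin m) (Fin r) R) (i : ℕ) :
    IsLocalOp i (fun g k => Del^[i] (TTop φ ψ g) k
      - (Del^[i] φ k).mulVec (Jop (fun j => (ψ j).mulVec (g j)) k)) := by
  induction i with
  | zero => exact IsLocalOp.zero.congr fun g _ k => by simp [TTop]
  | succ i ih =>
    refine (ih.del.add (IsLocalOp.term (i := 0)
      (fun k => Del^[i] φ (k + 1) * ψ k) (by omega))).congr fun g hg k => ?_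
    simp only [Function.iterate_succ_apply', Function.iterate_zero, id, Del,
      (hg.mulVec ψ).jop_add_one, Matrix.mulVec_add, Matrix.sub_mulVec, Matrix.mulVec_mulVec]
    abel

lemma Jop_smul_mulVec {p q : ℕ} (t : R) (a : ℤ → Matrix (Fin p) (Fin q) R)
    {g : ℤ → Fin q → R} (hg : SuppBddBelow g) (k : ℤ) :
    Jop (fun j => (t • a j).mulVec (g j)) k = t • Jop (fun j => (a j).mulVec (g j)) k := by
  have ha := hg.mulVec a
  refine (hg.mulVec fun j => t • a j).jop_eq
    (F := fun k => t • Jop (fun j => (a j).mulVec (g j)) k)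
    (ha.jop.of_imp fun j hj => by simp [hj]) (fun j => ?_) k
  rw [ha.jop_add_one, smul_add, Matrix.smul_mulVec]

lemma isLocalOp_Jop_mulVec_Del_iterate {r p : ℕ} (a : ℤ → Matrix (Fin p) (Fin r) R) (i : ℕ) :
    IsLocalOp i (fun g k => Jop (fun j => (a j).mulVec (Del^[i] g j)) k
      - Jop (fun j => (((-1 : R) ^ i) • Del^[i] (shiftLinv^[i] a) j).mulVec (g j)) k) := by
  induction i generalizing a with
  | zero => exact IsLocalOp.zero.congr fun g _ k => by simp
  | succ i ih =>
    refine ((IsLocalOp.term (fun k => a (k - 1)) (Nat.lt_succ_self i)).sub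
      ((ih (Del (shiftLinv a))).mono (Nat.le_succ i))).congr fun g hg k => ?_
    simp only [Function.iterate_succ_apply' Del i g, Jop_mulVec_Del a (hg.del_iterate i),
      Del_shiftLinv_iterate_succ, Jop_smul_mulVec _ _ hg]
    simp only [pow_succ, mul_neg, mul_one, neg_smul]
    abel

/-- there exist `c₀,…,c_{n-1}` such that, as operators on `V_r`,
`B∘T - T∘B = M_{B(φ)}∘J∘M_ψ - M_φ∘J∘M_{B*(ψ)} + Σ_{i=0}^{n-1} M_{c_i}∘Δⁱ`. -/
theorem stmt7 {r m n : ℕ} (b : ℕ → ℤ → Matrix (Fin r) (Fin r) R)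
    (φ : ℤ → Matrix (Fin r) (Fin m) R) (ψ : ℤ → Matrix (Fin m) (Fin r) R) :
    ∃ c : ℕ → ℤ → Matrix (Fin r) (Fin r) R,
      ∀ g : ℤ → Fin r → R, SuppBddBelow g → ∀ k : ℤ,
        Bop n b (TTop φ ψ g) k - TTop φ ψ (Bop n b g) k
          = (BMat n b φ k).mulVec (Jop (fun j => (ψ j).mulVec (g j)) k)
              - (φ k).mulVec (Jop (fun j => (BStarMat n b ψ j).mulVec (g j)) k)
              + ∑ i ∈ Finset.range n, (c i k).mulVec (Del^[i] g k) := by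
  have hlocal := IsLocalOp.sum (n := n) (s := Finset.range (n + 1)) fun i hi =>
    have hi : i ≤ n := Nat.lt_succ_iff.mp (Finset.mem_range.mp hi)
    (((isLocalOp_Del_iterate_TTop φ ψ i).mono hi).mulVec (b i)).sub
      (((isLocalOp_Jop_mulVec_Del_iterate (fun j => ψ j * b i j) i).mono hi).mulVec φ)
  obtain ⟨c, hc⟩ := hlocal
  refine ⟨c, fun g hg k => ?_⟩
  rw [← hc g hg k]
  have hT : TTop φ ψ (Bop n b g) k = ∑ i ∈ Finset.range (n + 1),
      (φ k).mulVec (Jop (fun j => (ψ j * b i j).mulVec (Del^[i] g j)) k) := by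
    rw [← Matrix.mulVec_sum,
      ← Jop_sum fun i _ => (hg.del_iterate i).mulVec (fun j => ψ j * b i j)]
    simp [TTop, Bop, Matrix.mulVec_sum]
  have hS : (φ k).mulVec (Jop (fun j => (BStarMat n b ψ j).mulVec (g j)) k)
      = ∑ i ∈ Finset.range (n + 1), (φ k).mulVec (Jop (fun j => (((-1 : R) ^ i) •
          Del^[i] (shiftLinv^[i] (fun j => ψ j * b i j)) j).mulVec (g j)) k) := by
    rw [← Matrix.mulVec_sum, ← Jop_sum fun i _ => hg.mulVec
      (fun j => ((-1 : R) ^ i) • Del^[i] (shiftLinv^[i] (fun j => ψ j * b i j)) j)]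
    simp [BStarMat, Matrix.sum_mulVec]
  rw [hT, hS]
  simp only [Bop, BMat, Matrix.sum_mulVec, Matrix.mulVec_sub, Finset.sum_sub_distrib,
    Matrix.mulVec_mulVec]
  abel
end
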